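/- arXiv:1507.00561 — 8 statements merged into one kernel-verified Lean document; each statement's English description precedes it below -/
import Mathlib

section
/- Let V be a subgroup of Γ = ℤ/2 * ℤ/2. Then V is a normal subgroup, stable under the swap automorphism σ, with V ≠ {1} and V ≠ Γ, if and only if V = ⟨(g₀g₁)^m⟩, the subgroup generated by (g₀g₁)^m, for some integer m ≥ 1. -/
/-- The group `ℤ/2 * ℤ/2`, presented by generators `g₀, g₁` and relations `g₀² = 1 = g₁²`. -/
def DInfRels : Set (FreeGroup (Fin 2)) := {FreeGroup.of 0 ^ 2, FreeGroup.of 1 ^ 2}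

abbrev DInf : Type := PresentedGroup DInfRels

/-- The generator `g₀` of `ℤ/2 * ℤ/2`. -/
def dg₀ : DInf := PresentedGroup.of 0

/-- The generator `g₁` of `ℤ/2 * ℤ/2`. -/
def dg₁ : DInf := PresentedGroup.of 1

namespace DInf

lemma dg₀_mul_self : dg₀ * dg₀ = 1 := by
  have h : (PresentedGroup.mk DInfRels) (FreeGroup.of 0 ^ 2) = 1 :=
    PresentedGroup.one_of_mem (by simp [DInfRels])
  rwa [map_pow, pow_two] at h

lemma dg₁_mul_self : dg₁ * dg₁ = 1 := by
  have h : (PresentedGroup.mk DInfRels) (FreeGroup.of 1 ^ 2) = 1 :=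
    PresentedGroup.one_of_mem (by simp [DInfRels])
  rwa [map_pow, pow_two] at h

lemma dg₀_inv : dg₀⁻¹ = dg₀ := inv_eq_of_mul_eq_one_left dg₀_mul_self

lemma dg₁_inv : dg₁⁻¹ = dg₁ := inv_eq_of_mul_eq_one_left dg₁_mul_self

lemma inv_dg₀_mul_dg₁ : (dg₀ * dg₁)⁻¹ = dg₁ * dg₀ := by
  rw [mul_inv_rev, dg₀_inv, dg₁_inv]

lemma dg₀_mul_zpow_mul_dg₀ (k : ℤ) : dg₀ * (dg₀ * dg₁) ^ k * dg₀ = (dg₀ * dg₁) ^ (-k) := by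
  have h := conj_zpow (i := k) (a := dg₀) (b := dg₀ * dg₁)
  rw [dg₀_inv, ← mul_assoc, dg₀_mul_self, one_mul, ← inv_dg₀_mul_dg₁, inv_zpow'] at h
  exact h.symm

lemma dg₀_mul_zpow (k : ℤ) : dg₀ * (dg₀ * dg₁) ^ k = (dg₀ * dg₁) ^ (-k) * dg₀ := by
  rw [← dg₀_mul_zpow_mul_dg₀, mul_assoc, dg₀_mul_self, mul_one]

lemma closure_generators : Subgroup.closure {dg₀, dg₁} = (⊤ : Subgroup DInf) := by
  rw [← PresentedGroup.closure_range_of]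
  congr 1
  ext x
  simp [Fin.exists_fin_two, dg₀, dg₁, eq_comm]

/-- Every element is a rotation or a reflection. -/
lemma eq_zpow_or_eq_zpow_mul (x : DInf) :
    ∃ k : ℤ, x = (dg₀ * dg₁) ^ k ∨ x = (dg₀ * dg₁) ^ k * dg₀ := by
  have hx : x ∈ Subgroup.closure {dg₀, dg₁} := closure_generators ▸ Subgroup.mem_top x
  induction hx using Subgroup.closure_induction with
  | mem x hx =>
    rcases hx with rfl | rfl
    · exact ⟨0, by simp⟩
    · refine ⟨-1, Or.inr ?_⟩
      rw [zpow_neg_one, inv_dg₀_mul_dg₁, mul_assoc, dg₀_mul_self, mul_one]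
  | one => exact ⟨0, by simp⟩
  | mul x y _ _ hx hy =>
    obtain ⟨k, rfl | rfl⟩ := hx <;> obtain ⟨l, rfl | rfl⟩ := hy
    · exact ⟨k + l, Or.inl (zpow_add _ _ _).symm⟩
    · exact ⟨k + l, Or.inr (by rw [zpow_add, mul_assoc])⟩
    · exact ⟨k + -l, Or.inr (by rw [mul_assoc, dg₀_mul_zpow, zpow_add, mul_assoc])⟩
    · refine ⟨k + -l, Or.inl ?_⟩
      rw [mul_assoc, ← mul_assoc dg₀, dg₀_mul_zpow_mul_dg₀, zpow_add]
  | inv x _ hx =>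
    obtain ⟨k, rfl | rfl⟩ := hx
    · exact ⟨-k, Or.inl (zpow_neg _ _).symm⟩
    · refine ⟨k, Or.inr ?_⟩
      rw [mul_inv_rev, dg₀_inv, ← zpow_neg, dg₀_mul_zpow, neg_neg]

/-- The homomorphism to the infinite dihedral group sending `g₀ g₁` to the rotation `r 1`. -/
def toDihedral : DInf →* DihedralGroup 0 :=
  PresentedGroup.toGroup (f := ![DihedralGroup.sr 0, DihedralGroup.sr 1]) (by
    rintro r (rfl | rfl) <;> simp [pow_two])

lemma toDihedral_dg₀ : toDihedral dg₀ = DihedralGroup.sr 0 :=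
  PresentedGroup.toGroup.of _

lemma toDihedral_dg₁ : toDihedral dg₁ = DihedralGroup.sr 1 :=
  PresentedGroup.toGroup.of _

lemma toDihedral_pow (m : ℕ) :
    toDihedral ((dg₀ * dg₁) ^ m) = DihedralGroup.r (m : ZMod 0) := by
  rw [map_pow, map_mul, toDihedral_dg₀, toDihedral_dg₁, DihedralGroup.sr_mul_sr, sub_zero,
    DihedralGroup.r_one_pow]

lemma pow_ne_one {m : ℕ} (hm : 1 ≤ m) : (dg₀ * dg₁) ^ m ≠ 1 := by
  intro h
  have h' := congrArg toDihedral h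
  rw [toDihedral_pow, map_one, DihedralGroup.one_def, DihedralGroup.r.injEq] at h'
  have : (m : ℤ) = 0 := h'
  omega

lemma dg₀_notMem_zpowers (m : ℕ) : dg₀ ∉ Subgroup.zpowers ((dg₀ * dg₁) ^ m) := by
  rintro ⟨k, hk⟩
  have h := congrArg toDihedral hk
  simp only [map_zpow, toDihedral_pow, toDihedral_dg₀, DihedralGroup.r_zpow, reduceCtorEq] at h

lemma normal_zpowers (m : ℕ) : (Subgroup.zpowers ((dg₀ * dg₁) ^ m)).Normal := by
  refine ⟨?_⟩
  rintro _ ⟨j, rfl⟩ x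
  simp only [← zpow_natCast, ← zpow_mul]
  obtain ⟨k, rfl | rfl⟩ := eq_zpow_or_eq_zpow_mul x
  · refine ⟨j, ?_⟩
    simp only [← zpow_mul]
    rw [← zpow_neg, ← zpow_add, ← zpow_add]
    congr 1
    ring
  · refine ⟨-j, ?_⟩
    simp only [← zpow_mul]
    rw [mul_inv_rev, dg₀_inv, mul_assoc _ dg₀, dg₀_mul_zpow, mul_assoc _ (_ * dg₀),
      mul_assoc _ dg₀, ← mul_assoc dg₀, dg₀_mul_self, one_mul, ← zpow_neg, ← zpow_add,
      ← zpow_add]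
    congr 1
    ring

lemma eq_top_of_mem {V : Subgroup DInf} (h₀ : dg₀ ∈ V) (h₁ : dg₁ ∈ V) : V = ⊤ := by
  rw [eq_top_iff, ← closure_generators, Subgroup.closure_le]
  rintro x (rfl | rfl)
  exacts [h₀, h₁]

/-- A normal subgroup containing a reflection contains one of the two generators. -/
lemma dg₀_mem_or_dg₁_mem {V : Subgroup DInf} (hV : V.Normal) {k : ℤ}
    (hk : (dg₀ * dg₁) ^ k * dg₀ ∈ V) : dg₀ ∈ V ∨ dg₁ ∈ V := by
  obtain ⟨j, hj⟩ := Int.even_or_odd' k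
  have h := hV.conj_mem _ hk ((dg₀ * dg₁) ^ (-j))
  rw [← zpow_neg, neg_neg, mul_assoc, mul_assoc, dg₀_mul_zpow, ← mul_assoc, ← mul_assoc,
    ← zpow_add, ← zpow_add] at h
  rcases hj with rfl | rfl
  · left
    rwa [show -j + 2 * j + -j = 0 by ring, zpow_zero, one_mul] at h
  · right
    rw [show -j + (2 * j + 1) + -j = 1 by ring, zpow_one] at h
    have h' := hV.conj_mem _ h dg₀
    rwa [dg₀_inv, ← mul_assoc, ← mul_assoc, dg₀_mul_self, one_mul, mul_assoc, dg₀_mul_self,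
      mul_one] at h'

end DInf

/-- Let `σ` be the automorphism of `Γ = ℤ/2 * ℤ/2` exchanging `g₀` and `g₁`,
and let `V` be a subgroup of `Γ`. Then `V` is normal, stable under `σ`, with `V ≠ {1}` and
`V ≠ Γ`, if and only if `V = ⟨(g₀ g₁)^m⟩` for some integer `m ≥ 1`. -/
theorem stmt3 (σ : DInf ≃* DInf) (hσ₀ : σ dg₀ = dg₁) (hσ₁ : σ dg₁ = dg₀)
    (V : Subgroup DInf) :
    (V.Normal ∧ Subgroup.map σ.toMonoidHom V = V ∧ V ≠ ⊥ ∧ V ≠ ⊤) ↔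
      ∃ m : ℕ, 1 ≤ m ∧ V = Subgroup.zpowers ((dg₀ * dg₁) ^ m) := by
  have hσV {x : DInf} (h : Subgroup.map σ.toMonoidHom V = V) (hx : x ∈ V) : σ x ∈ V := by
    rw [← h]
    exact Subgroup.mem_map_of_mem σ.toMonoidHom hx
  constructor
  · rintro ⟨hN, hmap, hbot, htop⟩
    have hle : V ≤ Subgroup.zpowers (dg₀ * dg₁) := by
      intro x hx
      obtain ⟨k, rfl | rfl⟩ := DInf.eq_zpow_or_eq_zpow_mul x
      · exact ⟨k, rfl⟩
      · refine absurd ?_ htop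
        rcases DInf.dg₀_mem_or_dg₁_mem hN hx with h | h
        · exact DInf.eq_top_of_mem h (hσ₀ ▸ hσV hmap h)
        · exact DInf.eq_top_of_mem (hσ₁ ▸ hσV hmap h) h
    have hcyc : IsCyclic V := Subgroup.isCyclic_of_le hle
    obtain ⟨g, hg⟩ := V.isCyclic_iff_exists_zpowers_eq_top.mp hcyc
    obtain ⟨k, rfl⟩ := hle (hg ▸ Subgroup.mem_zpowers g)
    have hV : V = Subgroup.zpowers ((dg₀ * dg₁) ^ k.natAbs) := by
      rw [← hg]
      rcases Int.natAbs_eq k with h | h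
      · conv_lhs => rw [h]
        simp only [zpow_natCast]
      · conv_lhs => rw [h]
        simp only [zpow_neg, zpow_natCast, Subgroup.zpowers_inv]
    refine ⟨k.natAbs, ?_, hV⟩
    by_contra hk
    obtain hk : k.natAbs = 0 := by omega
    rw [hk, pow_zero, Subgroup.zpowers_one_eq_bot] at hV
    exact hbot hV
  · rintro ⟨m, hm, rfl⟩
    refine ⟨DInf.normal_zpowers m, ?_, ?_, ?_⟩
    · rw [MonoidHom.map_zpowers, MulEquiv.toMonoidHom_eq_coe, MonoidHom.coe_coe, map_pow, map_mul,
        hσ₀, hσ₁, ← DInf.inv_dg₀_mul_dg₁, inv_pow, Subgroup.zpowers_inv]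
    · rw [Ne, Subgroup.zpowers_eq_bot]
      exact DInf.pow_ne_one hm
    · intro h
      exact DInf.dg₀_notMem_zpowers m (h ▸ Subgroup.mem_top _)
end

section
/- Let A be an abelian group, p a prime number, and let ℤ/pℤ act on A by automorphisms; form the semidirect product A ⋊ ℤ/pℤ. If V is a normal subgroup of A ⋊ ℤ/pℤ containing some element whose ℤ/pℤ-component is nontrivial (i.e. V is not contained in the canonical copy of A), then the quotient group (A ⋊ ℤ/pℤ)/V is commutative. -/
/-- If `G` has prime order and the subgroup `V` of `N ⋊ G` is not contained in `N`, then `N` meets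
every left coset of `V`. -/
theorem SemidirectProduct.exists_mk_inl_eq_of_prime_card {N G : Type*} [Group N] [Group G]
    {φ : G →* MulAut N} {p : ℕ} [Fact p.Prime] (hG : Nat.card G = p)
    {V : Subgroup (N ⋊[φ] G)} {v : N ⋊[φ] G} (hv : v ∈ V) (hv' : v.right ≠ 1)
    (x : (N ⋊[φ] G) ⧸ V) :
    ∃ a : N, QuotientGroup.mk (SemidirectProduct.inl a) = x := by
  obtain ⟨g, rfl⟩ := QuotientGroup.mk_surjective x
  obtain ⟨k, hk⟩ := Subgroup.mem_zpowers_iff.mp (mem_zpowers_of_prime_card hG hv' (g' := g.right))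
  have hr : (g * (v ^ k)⁻¹).right = 1 := by
    have h : (v ^ k).right = v.right ^ k :=
      map_zpow (SemidirectProduct.rightHom : N ⋊[φ] G →* G) v k
    rw [SemidirectProduct.mul_right, SemidirectProduct.inv_right, h, hk, mul_inv_cancel]
  have hl : SemidirectProduct.inl (g * (v ^ k)⁻¹).left = g * (v ^ k)⁻¹ :=
    SemidirectProduct.ext (SemidirectProduct.left_inl _) (by rw [hr, SemidirectProduct.right_inl])
  exact ⟨(g * (v ^ k)⁻¹).left, by
    rw [hl]
    exact QuotientGroup.mk_mul_of_mem g (V.inv_mem (V.zpow_mem hv k))⟩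

/-- Let `A` be an abelian group, `p` a prime, and let `ℤ/pℤ` act on `A` by
automorphisms; form `A ⋊ ℤ/pℤ`. If `V` is a normal subgroup of `A ⋊ ℤ/pℤ` containing an
element whose `ℤ/pℤ`-component is nontrivial, then `(A ⋊ ℤ/pℤ)/V` is commutative. -/
theorem stmt8 (p : ℕ) (hp : p.Prime) (A : Type*) [CommGroup A]
    (φ : Multiplicative (ZMod p) →* MulAut A)
    (V : Subgroup (A ⋊[φ] Multiplicative (ZMod p))) [V.Normal]
    (hV : ∃ v ∈ V, SemidirectProduct.right v ≠ 1) :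
    ∀ x y : (A ⋊[φ] Multiplicative (ZMod p)) ⧸ V, x * y = y * x := by
  have := Fact.mk hp
  obtain ⟨v, hv, hv'⟩ := hV
  have hcard : Nat.card (Multiplicative (ZMod p)) = p :=
    Nat.card_zmod p
  intro x y
  obtain ⟨a, rfl⟩ := SemidirectProduct.exists_mk_inl_eq_of_prime_card hcard hv hv' x
  obtain ⟨b, rfl⟩ := SemidirectProduct.exists_mk_inl_eq_of_prime_card hcard hv hv' y
  rw [← QuotientGroup.mk_mul, ← QuotientGroup.mk_mul, ← map_mul, ← map_mul, mul_comm]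
end

section
/- Let f : ℚ^{p−1} → ℚ^{p−1} be the linear map whose matrix B (rows and columns indexed by 0, …, p−2) is given by B_{i,j} = −1 if i = 0, B_{i,j} = 1 if i ≠ 0 and i = j+1, and B_{i,j} = 0 otherwise (first row all −1, subdiagonal entries 1, all other entries 0). Then for every nonzero u ∈ ℚ^{p−1}, the p−1 vectors u, f(u), f²(u), …, f^{p−2}(u) are linearly independent over ℚ. -/
open Polynomial in
/-- If an irreducible polynomial annihilates the matrix `B`, then the first `P.natDegree` iterates
of `B` on any nonzero vector are linearly independent. -/
theorem Matrix.linearIndependent_pow_mulVec_of_irreducible {K ι : Type*} [Field K] [Fintype ι]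
    [DecidableEq ι] {B : Matrix ι ι K} {P : K[X]} (hP : Irreducible P) (hPB : aeval B P = 0)
    {u : ι → K} (hu : u ≠ 0) :
    LinearIndependent K (fun t : Fin P.natDegree => (B ^ (t : ℕ)).mulVec u) := by
  rw [Fintype.linearIndependent_iff]
  intro c hc
  set q : K[X] := ∑ t : Fin P.natDegree, C (c t) * X ^ (t : ℕ) with hq
  have hqB : (aeval B q).mulVec u = 0 := by
    rw [← hc, hq, map_sum, Matrix.sum_mulVec]
    refine Finset.sum_congr rfl fun t _ => ?_
    rw [map_mul, map_pow, aeval_X, aeval_C, ← Algebra.smul_def, Matrix.smul_mulVec]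
  have hdeg : q.degree < P.degree := by
    rw [degree_eq_natDegree hP.ne_zero]
    exact degree_sum_fin_lt c
  have hq0 : q = 0 := by
    by_contra hne
    obtain ⟨a, b, hab⟩ := (hP.coprime_iff_not_dvd).2 fun h => hne (eq_zero_of_dvd_of_degree_lt h hdeg)
    apply hu
    have h := congrArg (fun r => (aeval B r).mulVec u) hab
    simpa [hPB, ← Matrix.mulVec_mulVec, hqB] using h.symm
  intro i
  have h := congrArg (fun r => r.coeff (i : ℕ)) hq0
  simpa [hq, finsetSum_coeff, coeff_X_pow, Fin.val_inj] using h

open scoped Matrix in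
/-- The powers `B ^ 0, …, B ^ n` of the `n × n` matrix with first row `-1` and subdiagonal `1`
sum to zero. -/
theorem Matrix.sum_pow_eq_zero_of_companion {R : Type*} [CommRing R] {n : ℕ}
    {B : Matrix (Fin n) (Fin n) R}
    (hB : ∀ i j, B i j =
      if (i : ℕ) = 0 then -1 else if (i : ℕ) = (j : ℕ) + 1 then 1 else 0) :
    ∑ k ∈ Finset.range (n + 1), B ^ k = 0 := by
  have hrow : ∀ k, ∀ i j : Fin n, (j : ℕ) + k = i →
      Pi.single i 1 ᵥ* B ^ k = Pi.single j 1 := by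
    intro k
    induction k with
    | zero =>
      intro i j h
      obtain rfl : j = i := Fin.ext h
      simp
    | succ k ih =>
      intro i j h
      have hj : (j : ℕ) + 1 < n := by omega
      rw [pow_succ, ← Matrix.vecMul_vecMul, ih i ⟨j + 1, hj⟩ (by simp only; omega),
        Matrix.single_one_vecMul]
      ext l
      simp [Matrix.row, hB, Pi.single_apply, Fin.ext_iff, eq_comm]
  ext i j
  have hn : 0 < n := i.pos
  let last : Fin n := ⟨n - 1, by omega⟩
  have hlast : Pi.single last 1 ᵥ* ∑ k ∈ Finset.range (n + 1), B ^ k = 0 := by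
    rw [Matrix.vecMul_sum, Finset.sum_range_succ, ← Finset.sum_range_reflect,
      Finset.sum_range]
    have h1 : ∀ t : Fin n, Pi.single last 1 ᵥ* B ^ (n - 1 - (t : ℕ)) = Pi.single t 1 :=
      fun t => hrow _ _ _ (by simp only [last]; omega)
    have h2 : Pi.single last 1 ᵥ* B ^ n = fun _ => -1 := by
      obtain ⟨m, rfl⟩ : ∃ m, n = m + 1 := ⟨n - 1, by omega⟩
      rw [pow_succ, ← Matrix.vecMul_vecMul, hrow m last 0 (by simp [last]),
        Matrix.single_one_vecMul]
      ext l
      simp [Matrix.row, hB]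
    simp only [h1, h2]
    ext l
    simp [Finset.sum_apply, Pi.single_apply]
  have hcomm : Commute (B ^ (n - 1 - (i : ℕ))) (∑ k ∈ Finset.range (n + 1), B ^ k) :=
    Commute.sum_right _ _ _ fun k _ => Commute.pow_pow_self B _ _
  have h : Pi.single i 1 ᵥ* ∑ k ∈ Finset.range (n + 1), B ^ k = 0 := by
    rw [← hrow (n - 1 - (i : ℕ)) last i (by simp only [last]; omega), Matrix.vecMul_vecMul,
      hcomm.eq, ← Matrix.vecMul_vecMul, hlast, Matrix.zero_vecMul]
  rw [Matrix.single_one_vecMul] at h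
  exact congrFun h j

/-- Let `p` be prime and let `f : ℚ^{p-1} → ℚ^{p-1}` be given by the matrix
with first row all `-1`, subdiagonal entries `1` and all other entries `0`. Then for every
nonzero `u`, the vectors `u, f(u), …, f^{p-2}(u)` are linearly independent over `ℚ`. -/
theorem stmt10 (p : ℕ) (hp : p.Prime)
    (B : Matrix (Fin (p - 1)) (Fin (p - 1)) ℚ)
    (hB : ∀ i j, B i j =
      if (i : ℕ) = 0 then -1 else if (i : ℕ) = (j : ℕ) + 1 then 1 else 0) :
    ∀ u : Fin (p - 1) → ℚ, u ≠ 0 →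
      LinearIndependent ℚ (fun t : Fin (p - 1) => (B ^ (t : ℕ)).mulVec u) := by
  intro u hu
  have : Fact p.Prime := ⟨hp⟩
  have hdeg : (Polynomial.cyclotomic p ℚ).natDegree = p - 1 := by
    rw [Polynomial.natDegree_cyclotomic, Nat.totient_prime hp]
  have hann : Polynomial.aeval B (Polynomial.cyclotomic p ℚ) = 0 := by
    have h := Matrix.sum_pow_eq_zero_of_companion hB
    rw [Nat.sub_add_cancel hp.one_le] at h
    simpa [Polynomial.cyclotomic_prime] using h
  have h := Matrix.linearIndependent_pow_mulVec_of_irreducible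
    (Polynomial.cyclotomic.irreducible_rat hp.pos) hann hu
  exact h.comp (Fin.cast hdeg.symm) (Fin.cast_injective _)
end

section
/- If at least one of the elements Q_{ic} with 1 ≤ i ≤ M−1 and 1 ≤ c ≤ N−1 is not a root of unity in k, then the subgroup of the group of functions {1,…,N−1} → kˣ (under pointwise multiplication) generated by the elements v_{ic}, where v_{ic}(d) = θ_{ic} · θ_{0c}⁻¹ · θ_{i,c+d}⁻¹ · θ_{0,c+d} for 1 ≤ d ≤ N−1, taken over all 1 ≤ i ≤ M−1 and 1 ≤ c ≤ N−1, is an infinite group. -/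
theorem ZMod.eq_apply_zero_of_apply_sub_one {α : Type*} {n : ℕ} [NeZero n] {g : ZMod n → α}
    (h : ∀ c, g c = g (c - 1)) (c : ZMod n) : g c = g 0 := by
  have key : ∀ m : ℕ, g (m : ZMod n) = g 0 := by
    intro m
    induction m with
    | zero => simp
    | succ m ih => rw [h, Nat.cast_succ, add_sub_cancel_right, ih]
  simpa using key c.val

theorem ZMod.exists_fin_natCast_succ_eq {n : ℕ} [NeZero n] {c : ZMod n} (hc : c ≠ 0) :
    ∃ j : Fin (n - 1), (((j : ℕ) + 1 : ℕ) : ZMod n) = c := by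
  have h0 : 0 < c.val := Nat.pos_of_ne_zero fun h => hc ((ZMod.val_eq_zero c).mp h)
  have hlt := c.val_lt
  refine ⟨⟨c.val - 1, by omega⟩, ?_⟩
  have : c.val - 1 + 1 = c.val := by omega
  simp only [this, ZMod.natCast_val, ZMod.cast_id', id]

theorem ZMod.sum_sub_apply_sub_one {A : Type*} [AddCommGroup A] {n : ℕ} [NeZero n]
    (g : ZMod n → A) : ∑ c, (g c - g (c - 1)) = 0 := by
  rw [Finset.sum_sub_distrib, sub_eq_zero]
  exact ((Equiv.subRight (1 : ZMod n)).sum_comp g).symm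

/-- A function on `ℤ/m × ℤ/n` that vanishes on both axes is zero as soon as its mixed differences
`t i c` are such that `t i c - t 0 c` does not depend on `c`. -/
theorem eq_zero_of_mixed_difference {A : Type*} [AddCommGroup A] [IsAddTorsionFree A] {m n : ℕ}
    [NeZero m] [NeZero n] {q t : ZMod m → ZMod n → A} (hqr : ∀ i, q i 0 = 0)
    (hqc : ∀ c, q 0 c = 0)
    (ht : ∀ i c, t i c = q (i - 1) c + q i (c - 1) - q i c - q (i - 1) (c - 1))
    (hconst : ∀ i c c', t i c - t 0 c = t i c' - t 0 c') (i : ZMod m) (c : ZMod n) :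
    q i c = 0 := by
  have hsum_right : ∀ i, ∑ c, t i c = 0 := by
    intro i
    rw [← ZMod.sum_sub_apply_sub_one fun c => q (i - 1) c - q i c]
    refine Finset.sum_congr rfl fun c _ => ?_
    rw [ht]
    abel
  have hsum_left : ∀ c, ∑ i, t i c = 0 := by
    intro c
    rw [← ZMod.sum_sub_apply_sub_one fun i => q i (c - 1) - q i c]
    refine Finset.sum_congr rfl fun i _ => ?_
    rw [ht]
    abel
  have hrow : ∀ i c, t i c = t 0 c := by
    intro i c
    have h : ∑ c', (t i c' - t 0 c') = 0 := by
      rw [Finset.sum_sub_distrib, hsum_right, hsum_right, sub_zero]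
    rw [Finset.sum_congr rfl fun c' _ => hconst i c' c, Finset.sum_const, Finset.card_univ,
      ZMod.card, nsmul_eq_zero_iff_right (NeZero.ne n)] at h
    exact sub_eq_zero.mp h
  have hzero : ∀ i c, t i c = 0 := by
    intro i c
    have h := hsum_left c
    rw [Finset.sum_congr rfl fun i _ => hrow i c, Finset.sum_const, Finset.card_univ,
      ZMod.card, nsmul_eq_zero_iff_right (NeZero.ne m)] at h
    rw [hrow, h]
  have hdiff : ∀ c i, q i c - q i (c - 1) = 0 := by
    intro c i
    have hstep : ∀ i, q i c - q i (c - 1) = q (i - 1) c - q (i - 1) (c - 1) := by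
      intro i
      have h := hzero i c
      rw [ht] at h
      rw [← sub_eq_zero, ← neg_eq_zero, ← h]
      abel
    rw [ZMod.eq_apply_zero_of_apply_sub_one (g := fun i => q i c - q i (c - 1)) hstep i,
      hqc, hqc, sub_zero]
  rw [ZMod.eq_apply_zero_of_apply_sub_one (fun c => sub_eq_zero.mp (hdiff c i)) c, hqr]

/-- (`char k = 0`.) If at least one of the `Q_{ic}` (`1 ≤ i ≤ M-1`,
`1 ≤ c ≤ N-1`) is not a root of unity, then the subgroup of the group of functions
`{1,…,N-1} → kˣ` generated by the elements `v_{ic}`, where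
`v_{ic}(d) = θ_{ic} θ_{0c}⁻¹ θ_{i,c+d}⁻¹ θ_{0,c+d}`, is infinite. (This is the group
`I_Q^0` of the paper; an index `t : Fin (M-1)` (resp. `Fin (N-1)`) encodes the integer
`t + 1 ∈ {1, …, M-1}` (resp. `{1, …, N-1}`).) -/
theorem stmt15 {k : Type*} [Field k] [CharZero k] (M N : ℕ) (hM : 2 ≤ M) (hN : 2 ≤ N)
    [NeZero M] [NeZero N]
    (Q : ZMod M → ZMod N → kˣ)
    (hQr : ∀ i, Q i 0 = 1) (hQc : ∀ c, Q 0 c = 1)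
    (θ : ZMod M → ZMod N → kˣ)
    (hθ : ∀ i c, θ i c = Q (i - 1) c * Q i (c - 1) * (Q i c)⁻¹ * (Q (i - 1) (c - 1))⁻¹)
    (v : Fin (M - 1) → Fin (N - 1) → (Fin (N - 1) → kˣ))
    (hv : ∀ i c d, v i c d =
      θ (((i : ℕ) + 1 : ℕ) : ZMod M) (((c : ℕ) + 1 : ℕ) : ZMod N) *
      (θ 0 (((c : ℕ) + 1 : ℕ) : ZMod N))⁻¹ *
      (θ (((i : ℕ) + 1 : ℕ) : ZMod M)
        ((((c : ℕ) + 1 : ℕ) : ZMod N) + (((d : ℕ) + 1 : ℕ) : ZMod N)))⁻¹ *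
      θ 0 ((((c : ℕ) + 1 : ℕ) : ZMod N) + (((d : ℕ) + 1 : ℕ) : ZMod N)))
    (hroot : ∃ (i : Fin (M - 1)) (c : Fin (N - 1)),
      ¬ IsOfFinOrder (Q (((i : ℕ) + 1 : ℕ) : ZMod M) (((c : ℕ) + 1 : ℕ) : ZMod N))) :
    Infinite (Subgroup.closure
      (Set.range fun t : Fin (M - 1) × Fin (N - 1) => v t.1 t.2) :
        Subgroup (Fin (N - 1) → kˣ)) := by
  by_contra hinf
  rw [not_infinite_iff_finite] at hinf
  have hfin : ∀ i c d, IsOfFinOrder (v i c d) := fun i c d =>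
    ((Pi.evalMonoidHom (fun _ : Fin (N - 1) => kˣ) d).comp (Subgroup.subtype _)).isOfFinOrder
      (isOfFinOrder_of_finite (⟨v i c, Subgroup.subset_closure ⟨(i, c), rfl⟩⟩ :
        Subgroup.closure (Set.range fun t : Fin (M - 1) × Fin (N - 1) => v t.1 t.2)))
  let π : kˣ →* kˣ ⧸ CommGroup.torsion kˣ := QuotientGroup.mk' _
  have hπ : ∀ x, π x = 1 ↔ IsOfFinOrder x := fun x => QuotientGroup.eq_one_iff x
  let q : ZMod M → ZMod N → Additive (kˣ ⧸ CommGroup.torsion kˣ) :=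
    fun i c => Additive.ofMul (π (Q i c))
  let t : ZMod M → ZMod N → Additive (kˣ ⧸ CommGroup.torsion kˣ) :=
    fun i c => Additive.ofMul (π (θ i c))
  have ht : ∀ i c, t i c = q (i - 1) c + q i (c - 1) - q i c - q (i - 1) (c - 1) := by
    intro i c
    simp only [t, q, hθ, map_mul, map_inv, ofMul_mul, ofMul_inv, sub_eq_add_neg]
  have hconst_one : ∀ i c c', c ≠ 0 → t i c - t 0 c = t i c' - t 0 c' := by
    intro i c c' hc
    rcases eq_or_ne i 0 with rfl | hi
    · simp
    rcases eq_or_ne c' c with rfl | hcc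
    · rfl
    obtain ⟨i', hi'⟩ := ZMod.exists_fin_natCast_succ_eq hi
    obtain ⟨j, hj⟩ := ZMod.exists_fin_natCast_succ_eq hc
    obtain ⟨d, hd⟩ := ZMod.exists_fin_natCast_succ_eq (sub_ne_zero.mpr hcc)
    have h := congrArg Additive.ofMul ((hπ _).mpr (hfin i' j d))
    rw [hv, hi', hj, hd, add_sub_cancel] at h
    simp only [map_mul, map_inv, ofMul_mul, ofMul_inv, ofMul_one] at h
    rw [← sub_eq_zero, ← h]
    simp only [t]
    abel
  have : Fact (1 < N) := ⟨hN⟩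
  have hconst : ∀ i c c', t i c - t 0 c = t i c' - t 0 c' := fun i c c' =>
    (hconst_one i 1 c one_ne_zero).symm.trans (hconst_one i 1 c' one_ne_zero)
  obtain ⟨i, c, hic⟩ := hroot
  refine hic ((hπ _).mp (Additive.ofMul.injective ?_))
  exact eq_zero_of_mixed_difference (q := q) (fun i => by simp [q, hQr])
    (fun c => by simp [q, hQc]) ht hconst _ _
end

section
/- If the family of elements (Q_{ic})_{1 ≤ i ≤ M−1, 1 ≤ c ≤ N−1} of kˣ is root independent, then the family (θ_{ic})_{1 ≤ i ≤ M−1, 1 ≤ c ≤ N−1} is also root independent. -/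
/-- Summation by parts, written multiplicatively. -/
theorem prod_range_div_zpow {G : Type*} [CommGroup G] (f : ℕ → G) (r : ℕ → ℤ) (n : ℕ)
    (hf : f 0 = 1) (hr : r n = 0) :
    ∏ a ∈ Finset.range n, (f (a + 1) / f a) ^ r a =
      ∏ a ∈ Finset.range n, f (a + 1) ^ (r a - r (a + 1)) := by
  have key : ∀ m, ∏ a ∈ Finset.range m, (f (a + 1) / f a) ^ r a =
      (∏ a ∈ Finset.range m, f (a + 1) ^ (r a - r (a + 1))) * f m ^ r m := by
    intro m
    induction m with
    | zero => simp [hf]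
    | succ m ih =>
      rw [Finset.prod_range_succ, Finset.prod_range_succ, ih, div_zpow, zpow_sub, mul_assoc,
        mul_assoc, mul_div_cancel, inv_mul_cancel_right]
  rw [key, hr, zpow_zero, mul_one]

/-- Summation by parts in two variables, written multiplicatively. -/
theorem prod_range_prod_range_div_zpow {G : Type*} [CommGroup G] (f : ℕ → ℕ → G)
    (r : ℕ → ℕ → ℤ) (m n : ℕ) (hf : ∀ b, f 0 b = 1) (hf' : ∀ a, f a 0 = 1)
    (hr : ∀ b, r m b = 0) (hr' : ∀ a, r a n = 0) :
    ∏ a ∈ Finset.range m, ∏ b ∈ Finset.range n,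
        ((f (a + 1) (b + 1) / f a (b + 1)) / (f (a + 1) b / f a b)) ^ r a b =
      ∏ a ∈ Finset.range m, ∏ b ∈ Finset.range n,
        f (a + 1) (b + 1) ^ ((r a b - r a (b + 1)) - (r (a + 1) b - r (a + 1) (b + 1))) := by
  have h (a : ℕ) := prod_range_div_zpow (fun b => f (a + 1) b / f a b) (r a) n
    (by simp [hf']) (hr' a)
  simp only [h]
  rw [Finset.prod_comm]
  conv_rhs => rw [Finset.prod_comm]
  refine Finset.prod_congr rfl fun b _ => ?_
  exact prod_range_div_zpow (fun a => f a (b + 1)) (fun a => r a b - r a (b + 1)) m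
    (hf _) (by simp [hr])

theorem eq_zero_of_sub_succ_eq_zero {s : ℕ → ℤ} {n : ℕ} (hn : s n = 0)
    (h : ∀ b < n, s b - s (b + 1) = 0) {b : ℕ} (hb : b ≤ n) : s b = 0 := by
  induction hb using Nat.decreasingInduction with
  | self => exact hn
  | of_succ k hk ih => have := h k hk; lia


/-- If the family `(Q_{ic})_{1 ≤ i ≤ M-1, 1 ≤ c ≤ N-1}` of elements of `kˣ`
is root independent, then so is the family `(θ_{ic})_{1 ≤ i ≤ M-1, 1 ≤ c ≤ N-1}`.
(An index `t : Fin (M-1)` (resp. `Fin (N-1)`) encodes the integer `t + 1`.) -/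
theorem stmt16 {k : Type*} [Field k] (M N : ℕ) (hM : 2 ≤ M) (hN : 2 ≤ N)
    [NeZero M] [NeZero N]
    (Q : ZMod M → ZMod N → kˣ)
    (hQr : ∀ i, Q i 0 = 1) (hQc : ∀ c, Q 0 c = 1)
    (θ : ZMod M → ZMod N → kˣ)
    (hθ : ∀ i c, θ i c = Q (i - 1) c * Q i (c - 1) * (Q i c)⁻¹ * (Q (i - 1) (c - 1))⁻¹)
    (hQindep : ∀ r : Fin (M - 1) → Fin (N - 1) → ℤ,
      (∏ i : Fin (M - 1), ∏ c : Fin (N - 1),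
        Q (((i : ℕ) + 1 : ℕ) : ZMod M) (((c : ℕ) + 1 : ℕ) : ZMod N) ^ r i c) = 1 →
      r = 0) :
    ∀ r : Fin (M - 1) → Fin (N - 1) → ℤ,
      (∏ i : Fin (M - 1), ∏ c : Fin (N - 1),
        θ (((i : ℕ) + 1 : ℕ) : ZMod M) (((c : ℕ) + 1 : ℕ) : ZMod N) ^ r i c) = 1 →
      r = 0 := by
  intro r hr
  let R : ℕ → ℕ → ℤ := fun a b =>
    if h : a < M - 1 ∧ b < N - 1 then r ⟨a, h.1⟩ ⟨b, h.2⟩ else 0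
  have hRr (i : Fin (M - 1)) (c : Fin (N - 1)) : R i c = r i c := by simp [R]
  have hR (b : ℕ) : R (M - 1) b = 0 := by simp [R]
  have hR' (a : ℕ) : R a (N - 1) = 0 := by simp [R]
  let f : ℕ → ℕ → kˣ := fun a b => Q (a : ZMod M) (b : ZMod N)
  have hθf (a b : ℕ) : θ ((a + 1 : ℕ) : ZMod M) ((b + 1 : ℕ) : ZMod N) =
      ((f (a + 1) (b + 1) / f a (b + 1)) / (f (a + 1) b / f a b))⁻¹ := by
    simp only [hθ, f, Nat.cast_add, Nat.cast_one, add_sub_cancel_right, div_eq_mul_inv, mul_inv,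
      inv_inv]
    ac_rfl
  have hparts := prod_range_prod_range_div_zpow f R (M - 1) (N - 1)
    (by simp [f, hQc]) (by simp [f, hQr]) hR hR'
  simp only [Finset.prod_range] at hparts
  simp only [hθf, inv_zpow, Finset.prod_inv_distrib, inv_eq_one, ← hRr] at hr
  rw [hr] at hparts
  have hE := hQindep _ hparts.symm
  have hstep {b : ℕ} (hb : b < N - 1) {a : ℕ} (ha : a ≤ M - 1) : R a b - R a (b + 1) = 0 :=
    eq_zero_of_sub_succ_eq_zero (s := fun a => R a b - R a (b + 1)) (by simp [hR])
      (fun a ha => congrFun (congrFun hE ⟨a, ha⟩) ⟨b, hb⟩) ha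
  ext i c
  rw [← hRr]
  exact eq_zero_of_sub_succ_eq_zero (hR' i) (fun b hb => hstep hb i.2.le) c.2.le
end

section
/- Assume the family (Q_{ic})_{1 ≤ i ≤ M−1, 1 ≤ c ≤ N−1} is root independent. Then for every family of integers R = (R_{ic})_{1 ≤ i ≤ M−1, 1 ≤ c ≤ N−1}: if for every d with 1 ≤ d ≤ N−1 one has ∏_{i=1}^{M−1} ∏_{c=1}^{N−1} (θ_{ic} · θ_{0c}⁻¹ · θ_{i,c+d}⁻¹ · θ_{0,c+d})^{R_{ic}} = 1, then R_{ic} = 0 for all i, c. (That is, the group E_Q^0, the kernel of the homomorphism ℤ^{(M−1)(N−1)} → (kˣ)^{N−1} determined on the standard basis by these elements, is trivial.) -/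
theorem ZMod.eq_apply_zero_of_eq_apply_add_one {n : ℕ} [NeZero n] {f : ZMod n → ℤ}
    (h : ∀ c, c ≠ 0 → f c = f (c + 1)) (c : ZMod n) : f c = f 0 := by
  have htel : ∑ c, (f c - f (c + 1)) = 0 := by
    rw [Finset.sum_sub_distrib, sub_eq_zero]
    exact (Equiv.sum_comp (Equiv.addRight (1 : ZMod n)) f).symm
  rw [Finset.sum_eq_single 0 (fun c _ hc => sub_eq_zero.2 (h c hc)) (by simp)] at htel
  have hall : ∀ c, f c = f (c + 1) := fun c => by
    by_cases hc : c = 0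
    · rw [hc]; exact sub_eq_zero.1 htel
    · exact h c hc
  have hnat : ∀ t : ℕ, f t = f 0 := fun t => by
    induction t with
    | zero => simp
    | succ t ih => rw [Nat.cast_succ, ← hall, ih]
  simpa using hnat c.val

theorem ZMod.eq_zero_of_eq_apply_add_one_of_sum_eq_zero {n : ℕ} [NeZero n] {f : ZMod n → ℤ}
    (h : ∀ c, c ≠ 0 → f c = f (c + 1)) (hsum : ∑ c, f c = 0) (c : ZMod n) : f c = 0 := by
  have hconst := ZMod.eq_apply_zero_of_eq_apply_add_one h
  rw [hconst c]
  simpa [Finset.sum_congr rfl fun c _ => hconst c, NeZero.ne n] using hsum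

/-- Summation by parts for the mixed difference of `q`. -/
theorem ZMod.sum_smul_mixed_difference {A : Type*} [AddCommGroup A] {m n : ℕ} [NeZero m]
    [NeZero n] (q : ZMod m → ZMod n → A) (S : ZMod m → ZMod n → ℤ) :
    ∑ i, ∑ c, S i c • (q (i - 1) c + q i (c - 1) - q i c - q (i - 1) (c - 1)) =
      ∑ i, ∑ c, (S (i + 1) c + S i (c + 1) - S i c - S (i + 1) (c + 1)) • q i c := by
  have row : ∀ F : ZMod m → A, ∑ i, F (i + 1) = ∑ i, F i :=
    fun F => Equiv.sum_comp (Equiv.addRight (1 : ZMod m)) F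
  have col : ∀ F : ZMod n → A, ∑ c, F (c + 1) = ∑ c, F c :=
    fun F => Equiv.sum_comp (Equiv.addRight (1 : ZMod n)) F
  have h₁ : ∑ i, ∑ c, S (i + 1) c • q i c = ∑ i, ∑ c, S i c • q (i - 1) c := by
    rw [← row fun i => ∑ c, S i c • q (i - 1) c]
    simp
  have h₂ : ∑ i, ∑ c, S i (c + 1) • q i c = ∑ i, ∑ c, S i c • q i (c - 1) :=
    Finset.sum_congr rfl fun i _ => by
      rw [← col fun c => S i c • q i (c - 1)]
      simp
  have h₃ : ∑ i, ∑ c, S (i + 1) (c + 1) • q i c =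
      ∑ i, ∑ c, S i c • q (i - 1) (c - 1) := by
    rw [← row fun i => ∑ c, S i c • q (i - 1) (c - 1)]
    refine Finset.sum_congr rfl fun i _ => ?_
    rw [← col fun c => S (i + 1) c • q (i + 1 - 1) (c - 1)]
    simp
  simp only [smul_sub, smul_add, sub_smul, add_smul, Finset.sum_sub_distrib,
    Finset.sum_add_distrib, h₁, h₂, h₃]

theorem ZMod.eq_zero_of_sum_smul_mixed_difference {A : Type*} [AddCommGroup A] {m n : ℕ}
    [NeZero m] [NeZero n] (q θ : ZMod m → ZMod n → A)
    (hθ : ∀ i c, θ i c = q (i - 1) c + q i (c - 1) - q i c - q (i - 1) (c - 1))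
    (hq : ∀ f : ZMod m → ZMod n → ℤ, ∑ i, ∑ c, f i c • q i c = 0 →
      ∀ i c, i ≠ 0 → c ≠ 0 → f i c = 0)
    (T : ZMod m → ZMod n → ℤ) (hsum : ∀ c, ∑ i, T i c = 0) (hzero : ∀ i, T i 0 = 0)
    (h : ∀ d, ∑ i, ∑ c, T i c • (θ i c - θ i (c + d)) = 0) (i : ZMod m) (d : ZMod n) :
    T i d = 0 := by
  have hS : ∑ i, ∑ c, (T i c - T i (c - d)) • θ i c = 0 := by
    rw [← h d]
    refine Finset.sum_congr rfl fun i _ => ?_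
    simp only [sub_smul, smul_sub, Finset.sum_sub_distrib]
    rw [← Equiv.sum_comp (Equiv.addRight d) fun c => T i (c - d) • θ i c]
    simp
  simp only [hθ] at hS
  rw [ZMod.sum_smul_mixed_difference q fun i c => T i c - T i (c - d)] at hS
  have hmixed := hq _ hS
  have hcol : ∀ i, ∑ c, (T i c - T i (c - d)) = 0 := fun i => by
    rw [Finset.sum_sub_distrib, sub_eq_zero]
    exact (Equiv.sum_comp (Equiv.subRight d) (T i)).symm
  have hrow : ∀ c, ∑ i, (T i c - T i (c - d)) = 0 := fun c => by
    rw [Finset.sum_sub_distrib, hsum, hsum, sub_zero]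
  have hstep : ∀ i, i ≠ 0 → T i d - T i (d - d) = T (i + 1) d - T (i + 1) (d - d) := by
    intro i hi
    have := ZMod.eq_zero_of_eq_apply_add_one_of_sum_eq_zero
      (f := fun c => (T i c - T i (c - d)) - (T (i + 1) c - T (i + 1) (c - d)))
      (fun c hc => by linarith [hmixed i c hi hc])
      (by rw [Finset.sum_sub_distrib, hcol, hcol, sub_zero]) d
    exact sub_eq_zero.1 this
  have := ZMod.eq_zero_of_eq_apply_add_one_of_sum_eq_zero
    (f := fun i => T i d - T i (d - d)) hstep (hrow d) i
  simpa [hzero] using this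

theorem ZMod.sum_univ_succ {A : Type*} [AddCommMonoid A] {m : ℕ} (g : ZMod (m + 1) → A) :
    ∑ x, g x = g 0 + ∑ i : Fin m, g ((i : ℕ) + 1 : ℕ) := by
  refine (Fin.sum_univ_succ (n := m) g).trans ?_
  congr 1
  refine Finset.sum_congr rfl fun i _ => congrArg g ?_
  exact (Fin.cast_val_eq_self i.succ).symm

/-- The extension of `R` by zero on the column `0`, with row `0` chosen to make all sums over
the first index vanish. -/
def balancedExtension {m n : ℕ} (R : Fin m → Fin n → ℤ) (i : ZMod (m + 1)) (c : ZMod (n + 1)) :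
    ℤ :=
  Fin.cases (motive := fun _ => ℤ) 0
    (fun c' => Fin.cases (motive := fun _ => ℤ) (-∑ i', R i' c') (fun i' => R i' c') i) c

theorem balancedExtension_zero_right {m n : ℕ} (R : Fin m → Fin n → ℤ) (i : ZMod (m + 1)) :
    balancedExtension R i 0 = 0 := rfl

theorem balancedExtension_zero_left {m n : ℕ} (R : Fin m → Fin n → ℤ) (c : Fin n) :
    balancedExtension R 0 ((c : ℕ) + 1 : ℕ) = -∑ i, R i c := by
  rw [show (((c : ℕ) + 1 : ℕ) : ZMod (n + 1)) = c.succ from Fin.cast_val_eq_self c.succ]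
  rfl

theorem balancedExtension_succ {m n : ℕ} (R : Fin m → Fin n → ℤ) (i : Fin m) (c : Fin n) :
    balancedExtension R ((i : ℕ) + 1 : ℕ) ((c : ℕ) + 1 : ℕ) = R i c := by
  rw [show (((c : ℕ) + 1 : ℕ) : ZMod (n + 1)) = c.succ from Fin.cast_val_eq_self c.succ,
    show (((i : ℕ) + 1 : ℕ) : ZMod (m + 1)) = i.succ from Fin.cast_val_eq_self i.succ]
  rfl

theorem ZMod.eq_zero_or_exists_fin {m : ℕ} (x : ZMod (m + 1)) :
    x = 0 ∨ ∃ i : Fin m, x = ((i : ℕ) + 1 : ℕ) := by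
  rcases Fin.eq_zero_or_eq_succ (n := m) x with h | ⟨i, h⟩
  · exact Or.inl h
  · exact Or.inr ⟨i, h.trans (Fin.cast_val_eq_self i.succ).symm⟩

theorem sum_balancedExtension {m n : ℕ} (R : Fin m → Fin n → ℤ) (c : ZMod (n + 1)) :
    ∑ i, balancedExtension R i c = 0 := by
  rcases ZMod.eq_zero_or_exists_fin c with rfl | ⟨c, rfl⟩
  · simp only [balancedExtension_zero_right, Finset.sum_const_zero]
  · rw [ZMod.sum_univ_succ]
    simp only [balancedExtension_zero_left, balancedExtension_succ, neg_add_cancel]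

theorem sum_balancedExtension_smul {A : Type*} [AddCommGroup A] {m n : ℕ}
    (R : Fin m → Fin n → ℤ) (u : ZMod (m + 1) → ZMod (n + 1) → A) :
    ∑ i, ∑ c, balancedExtension R i c • u i c =
      ∑ i : Fin m, ∑ c : Fin n, R i c •
        (u ((i : ℕ) + 1 : ℕ) ((c : ℕ) + 1 : ℕ) - u 0 ((c : ℕ) + 1 : ℕ)) := by
  simp only [ZMod.sum_univ_succ, balancedExtension_zero_left, balancedExtension_succ,
    balancedExtension_zero_right, zero_smul, zero_add, smul_sub, Finset.sum_sub_distrib,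
    neg_smul, Finset.sum_smul, Finset.sum_neg_distrib]
  rw [Finset.sum_comm (f := fun (i : Fin m) (c : Fin n) =>
    R i c • u 0 (((c : ℕ) + 1 : ℕ) : ZMod (n + 1)))]
  abel


/-- Assume the family `(Q_{ic})_{1 ≤ i ≤ M-1, 1 ≤ c ≤ N-1}` is root
independent. Then for every integer family `R = (R_{ic})`: if for every `1 ≤ d ≤ N-1` one has
`∏_{i=1}^{M-1} ∏_{c=1}^{N-1} (θ_{ic} θ_{0c}⁻¹ θ_{i,c+d}⁻¹ θ_{0,c+d})^{R_{ic}} = 1`, then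
`R = 0`; i.e. the group `E_Q^0` is trivial. (An index `t : Fin (M-1)` (resp. `Fin (N-1)`)
encodes the integer `t + 1`.) -/
theorem stmt17 {k : Type*} [Field k] (M N : ℕ) (hM : 2 ≤ M) (hN : 2 ≤ N)
    [NeZero M] [NeZero N]
    (Q : ZMod M → ZMod N → kˣ)
    (hQr : ∀ i, Q i 0 = 1) (hQc : ∀ c, Q 0 c = 1)
    (θ : ZMod M → ZMod N → kˣ)
    (hθ : ∀ i c, θ i c = Q (i - 1) c * Q i (c - 1) * (Q i c)⁻¹ * (Q (i - 1) (c - 1))⁻¹)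
    (v : Fin (M - 1) → Fin (N - 1) → (Fin (N - 1) → kˣ))
    (hv : ∀ i c d, v i c d =
      θ (((i : ℕ) + 1 : ℕ) : ZMod M) (((c : ℕ) + 1 : ℕ) : ZMod N) *
      (θ 0 (((c : ℕ) + 1 : ℕ) : ZMod N))⁻¹ *
      (θ (((i : ℕ) + 1 : ℕ) : ZMod M)
        ((((c : ℕ) + 1 : ℕ) : ZMod N) + (((d : ℕ) + 1 : ℕ) : ZMod N)))⁻¹ *
      θ 0 ((((c : ℕ) + 1 : ℕ) : ZMod N) + (((d : ℕ) + 1 : ℕ) : ZMod N)))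
    (hQindep : ∀ r : Fin (M - 1) → Fin (N - 1) → ℤ,
      (∏ i : Fin (M - 1), ∏ c : Fin (N - 1),
        Q (((i : ℕ) + 1 : ℕ) : ZMod M) (((c : ℕ) + 1 : ℕ) : ZMod N) ^ r i c) = 1 →
      r = 0) :
    ∀ R : Fin (M - 1) → Fin (N - 1) → ℤ,
      (∀ d : Fin (N - 1),
        (∏ i : Fin (M - 1), ∏ c : Fin (N - 1), v i c d ^ R i c) = 1) →
      R = 0 := by
  obtain ⟨m, rfl⟩ : ∃ m, M = m + 1 := ⟨M - 1, by omega⟩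
  obtain ⟨n, rfl⟩ : ∃ n, N = n + 1 := ⟨N - 1, by omega⟩
  change Fin m → Fin n → Fin n → kˣ at v
  intro (R : Fin m → Fin n → ℤ) hR
  let q : ZMod (m + 1) → ZMod (n + 1) → Additive kˣ := fun i c => .ofMul (Q i c)
  let t : ZMod (m + 1) → ZMod (n + 1) → Additive kˣ := fun i c => .ofMul (θ i c)
  have ht : ∀ i c, t i c = q (i - 1) c + q i (c - 1) - q i c - q (i - 1) (c - 1) := fun i c => by
    simp only [t, q, hθ, ofMul_mul, ofMul_inv, sub_eq_add_neg]
  have hq : ∀ f : ZMod (m + 1) → ZMod (n + 1) → ℤ, ∑ i, ∑ c, f i c • q i c = 0 →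
      ∀ i c, i ≠ 0 → c ≠ 0 → f i c = 0 := by
    intro f hf i c hi hc
    obtain ⟨i, rfl⟩ := (ZMod.eq_zero_or_exists_fin i).resolve_left hi
    obtain ⟨c, rfl⟩ := (ZMod.eq_zero_or_exists_fin c).resolve_left hc
    have hq₀ : ∀ i, q i 0 = 0 := fun i => congrArg Additive.ofMul (hQr i)
    have hq₁ : ∀ c, q 0 c = 0 := fun c => congrArg Additive.ofMul (hQc c)
    simp only [ZMod.sum_univ_succ, hq₀, hq₁, smul_zero, zero_add,
      Finset.sum_const_zero] at hf
    exact congrFun (congrFun (hQindep (fun i c => f ((i : ℕ) + 1 : ℕ) ((c : ℕ) + 1 : ℕ)) hf) i) c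
  have key := ZMod.eq_zero_of_sum_smul_mixed_difference q t ht hq (balancedExtension R)
    (sum_balancedExtension R) (balancedExtension_zero_right R) (fun d => by
      rcases ZMod.eq_zero_or_exists_fin d with rfl | ⟨d, rfl⟩
      · simp
      · rw [sum_balancedExtension_smul R fun i c => t i c - t i (c + ((d : ℕ) + 1 : ℕ))]
        refine Eq.trans (Finset.sum_congr rfl fun i _ => Finset.sum_congr rfl fun c _ => ?_)
          (show ∑ i : Fin m, ∑ c : Fin n, R i c • Additive.ofMul (v i c d) = 0 from hR d)
        rw [hv]
        simp only [t, ofMul_mul, ofMul_inv]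
        congr 1
        abel)
  funext i c
  exact (balancedExtension_succ R i c).symm.trans (key _ _)
end

section
/- Let p, q ∈ kˣ be roots of unity, let m be the multiplicative order of p² and n the multiplicative order of q², and assume gcd(m, n) = 1, gcd(m, 3) = 1 and gcd(n, 3) = 1. Then for all integers α, β: the two equations (p²)^{−α+β} = (q²)^{α+2β} and (p²)^{2α+β} = (q²)^{α−β} hold if and only if mn divides α and mn divides β. -/
/-- Powers of two elements of coprime orders agree only when both are trivial. -/
theorem zpow_eq_zpow_iff_dvd_of_coprime {G : Type*} [Group G] {a b : G}
    (h : (orderOf a).Coprime (orderOf b)) (x y : ℤ) :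
    a ^ x = b ^ y ↔ (orderOf a : ℤ) ∣ x ∧ (orderOf b : ℤ) ∣ y := by
  have h' : IsCoprime (orderOf a : ℤ) (orderOf b : ℤ) := Nat.isCoprime_iff_coprime.mpr h
  refine ⟨fun e => ⟨?_, ?_⟩, fun ⟨hx, hy⟩ => ?_⟩
  · refine h'.dvd_of_dvd_mul_right (orderOf_dvd_iff_zpow_eq_one.mpr ?_)
    rw [zpow_mul, e, ← zpow_mul, mul_comm, zpow_mul, zpow_natCast, pow_orderOf_eq_one, one_zpow]
  · refine h'.symm.dvd_of_dvd_mul_right (orderOf_dvd_iff_zpow_eq_one.mpr ?_)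
    rw [zpow_mul, ← e, ← zpow_mul, mul_comm, zpow_mul, zpow_natCast, pow_orderOf_eq_one, one_zpow]
  · rw [orderOf_dvd_iff_zpow_eq_one.mp hx, orderOf_dvd_iff_zpow_eq_one.mp hy]

/-- Let `p, q ∈ kˣ` be roots of unity (`k` of characteristic zero), let
`m = o(p²)` and `n = o(q²)`, and assume `gcd(m,n) = gcd(m,3) = gcd(n,3) = 1`. Then for all
integers `α, β`: `(p²)^{-α+β} = (q²)^{α+2β}` and `(p²)^{2α+β} = (q²)^{α-β}` hold if and only
if `mn ∣ α` and `mn ∣ β`. -/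
theorem stmt18 {k : Type*} [Field k] [CharZero k] (p q : kˣ)
    (hp : IsOfFinOrder p) (hq : IsOfFinOrder q)
    (m n : ℕ) (hm : m = orderOf (p ^ 2)) (hn : n = orderOf (q ^ 2))
    (hmn : Nat.gcd m n = 1) (hm3 : Nat.gcd m 3 = 1) (hn3 : Nat.gcd n 3 = 1) :
    ∀ α β : ℤ,
      ((p ^ 2) ^ (-α + β) = (q ^ 2) ^ (α + 2 * β) ∧
       (p ^ 2) ^ (2 * α + β) = (q ^ 2) ^ (α - β)) ↔
      ((m * n : ℤ) ∣ α ∧ (m * n : ℤ) ∣ β) := by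
  intro α β
  subst hm hn
  have hc := Nat.isCoprime_iff_coprime.mpr hmn
  have hm3' : IsCoprime (orderOf (p ^ 2) : ℤ) 3 := Nat.isCoprime_iff_coprime.mpr hm3
  have hn3' : IsCoprime (orderOf (q ^ 2) : ℤ) 3 := Nat.isCoprime_iff_coprime.mpr hn3
  rw [zpow_eq_zpow_iff_dvd_of_coprime hmn, zpow_eq_zpow_iff_dvd_of_coprime hmn]
  constructor
  · rintro ⟨⟨h1, h2⟩, h3, h4⟩
    have hpα := hm3'.dvd_of_dvd_mul_left
      ((show 2 * α + β - (-α + β) = 3 * α by ring) ▸ dvd_sub h3 h1)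
    have hqβ := hn3'.dvd_of_dvd_mul_left
      ((show α + 2 * β - (α - β) = 3 * β by ring) ▸ dvd_sub h2 h4)
    have hpβ := (show -α + β + α = β by ring) ▸ dvd_add h1 hpα
    have hqα := (show α - β + β = α by ring) ▸ dvd_add h4 hqβ
    exact ⟨hc.mul_dvd hpα hqα, hc.mul_dvd hpβ hqβ⟩
  · rintro ⟨hα, hβ⟩
    have hpα := dvd_of_mul_right_dvd hα
    have hqα := dvd_of_mul_left_dvd hα
    have hpβ := dvd_of_mul_right_dvd hβ
    have hqβ := dvd_of_mul_left_dvd hβ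
    exact ⟨⟨dvd_add (dvd_neg.mpr hpα) hpβ, dvd_add hqα (hqβ.mul_left 2)⟩,
      dvd_add (hpα.mul_left 2) hpβ, dvd_sub hqα hqβ⟩
end

section
/- Let p ∈ kˣ be a root of unity, let m be the multiplicative order of p², and assume 3 divides m. Then the set L = {(α, β) ∈ ℤ² : (p²)^{−α+β} = (p²)^{α+2β} and (p²)^{2α+β} = (p²)^{α−β}} equals the subgroup of ℤ² generated by the two vectors (m, 0) and (−2(m/3), m/3); moreover the quotient group ℤ²/L is isomorphic to ℤ/mℤ × ℤ/(m/3)ℤ. -/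
/-- The subgroup of `ℤ²` generated by `(3n, 0)` and `(-2n, n)`, in terms of congruences. -/
theorem mem_closure_pair_iff_dvd (n : ℤ) (v : ℤ × ℤ) :
    v ∈ AddSubgroup.closure {(3 * n, (0 : ℤ)), (-2 * n, n)} ↔
      3 * n ∣ 2 * v.1 + v.2 ∧ n ∣ v.1 := by
  obtain ⟨x, y⟩ := v
  rw [AddSubgroup.mem_closure_pair]
  simp only [Prod.smul_mk, smul_eq_mul, Prod.mk_add_mk, Prod.mk.injEq]
  constructor
  · rintro ⟨a, b, rfl, rfl⟩
    exact ⟨⟨2 * a - b, by ring⟩, ⟨3 * a - 2 * b, by ring⟩⟩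
  · rintro ⟨⟨s, hs⟩, ⟨c, rfl⟩⟩
    exact ⟨2 * s - c, 3 * s - 2 * c, by ring, by linear_combination -hs⟩

/-- The homomorphism `(α, β) ↦ (2α + β mod a, α mod b)`. -/
def twoFstAddSndHom (a b : ℕ) : ℤ × ℤ →+ ZMod a × ZMod b where
  toFun v := (((2 * v.1 + v.2 : ℤ) : ZMod a), (v.1 : ZMod b))
  map_zero' := by simp
  map_add' v w := by
    ext
    · simp only [Prod.fst_add, Prod.snd_add]
      push_cast
      ring
    · simp

theorem twoFstAddSndHom_surjective (a b : ℕ) : Function.Surjective (twoFstAddSndHom a b) := by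
  rintro ⟨x, y⟩
  obtain ⟨x, rfl⟩ := ZMod.intCast_surjective x
  obtain ⟨y, rfl⟩ := ZMod.intCast_surjective y
  exact ⟨(y, x - 2 * y), by simp [twoFstAddSndHom]⟩

theorem mem_ker_twoFstAddSndHom (a b : ℕ) (v : ℤ × ℤ) :
    v ∈ (twoFstAddSndHom a b).ker ↔ (a : ℤ) ∣ 2 * v.1 + v.2 ∧ (b : ℤ) ∣ v.1 := by
  rw [AddMonoidHom.mem_ker, ← ZMod.intCast_zmod_eq_zero_iff_dvd,
    ← ZMod.intCast_zmod_eq_zero_iff_dvd]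
  exact Prod.mk_eq_zero


/-- Let `p ∈ kˣ` be a root of unity (`k` of characteristic zero), let
`m = o(p²)` and assume `3 ∣ m`. Then the set
`L = {(α, β) ∈ ℤ² | (p²)^{-α+β} = (p²)^{α+2β} and (p²)^{2α+β} = (p²)^{α-β}}` equals the
subgroup of `ℤ²` generated by `(m, 0)` and `(-2(m/3), m/3)`; moreover
`ℤ²/L ≃ ℤ/mℤ × ℤ/(m/3)ℤ`. -/
theorem stmt19 {k : Type*} [Field k] [CharZero k] (p : kˣ)
    (hp : IsOfFinOrder p) (m : ℕ) (hm : m = orderOf (p ^ 2)) (h3 : 3 ∣ m) :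
    {v : ℤ × ℤ | (p ^ 2) ^ (-v.1 + v.2) = (p ^ 2) ^ (v.1 + 2 * v.2) ∧
        (p ^ 2) ^ (2 * v.1 + v.2) = (p ^ 2) ^ (v.1 - v.2)} =
      ((AddSubgroup.closure {((m : ℤ), (0 : ℤ)), (-2 * ((m / 3 : ℕ) : ℤ), ((m / 3 : ℕ) : ℤ))} :
        AddSubgroup (ℤ × ℤ)) : Set (ℤ × ℤ)) ∧
    Nonempty
      ((ℤ × ℤ) ⧸
          (AddSubgroup.closure
            {((m : ℤ), (0 : ℤ)), (-2 * ((m / 3 : ℕ) : ℤ), ((m / 3 : ℕ) : ℤ))} :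
            AddSubgroup (ℤ × ℤ)) ≃+
        (ZMod m × ZMod (m / 3))) := by
  obtain ⟨n, rfl⟩ := h3
  have hn : 3 * n / 3 = n := by omega
  rw [hn]
  push_cast
  constructor
  · ext v
    rw [SetLike.mem_coe, mem_closure_pair_iff_dvd, Set.mem_ofPred_eq,
      zpow_eq_zpow_iff_modEq, zpow_eq_zpow_iff_modEq, ← hm, Int.modEq_iff_dvd, Int.modEq_iff_dvd]
    push_cast
    obtain ⟨x, y⟩ := v
    constructor
    · rintro ⟨⟨s, hs⟩, ⟨t, ht⟩⟩
      dsimp only at hs ht ⊢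
      exact ⟨⟨s, by linear_combination hs⟩, ⟨2 * s + t, by linarith⟩⟩
    · rintro ⟨⟨s, hs⟩, ⟨c, hc⟩⟩
      dsimp only at hs hc ⊢
      exact ⟨⟨s, by linear_combination hs⟩, ⟨c - 2 * s, by linear_combination 3 * hc - 2 * hs⟩⟩
  · have hker : AddSubgroup.closure {(3 * (n : ℤ), (0 : ℤ)), (-2 * (n : ℤ), (n : ℤ))} =
        (twoFstAddSndHom (3 * n) n).ker := by
      ext v
      rw [mem_closure_pair_iff_dvd, mem_ker_twoFstAddSndHom]
      push_cast
      rfl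
    exact ⟨(QuotientAddGroup.quotientAddEquivOfEq hker).trans
      (QuotientAddGroup.quotientKerEquivOfSurjective _ (twoFstAddSndHom_surjective _ _))⟩
end
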